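/- Let n be a nonnegative integer, r > 0 a real number, and κ, μ ∈ ℂ with Re(μ−κ+1/2) > 0 and with 2μ + t ≠ 0 for every integer t with 0 ≤ t ≤ 2n. Then Σ_{ℓ=0}^{n} (−1)^ℓ · binom(n,ℓ) · ((2μ+2ℓ)/(2μ+ℓ)_{n+1}) · W_{κ,μ+ℓ}(r) = (−1)^n · r^{−n/2} · W_{κ−n/2, μ+n/2}(r). -/

import Mathlib

open scoped BigOperators
open MeasureTheory

noncomputable section

/-- Ascending Pochhammer symbol `(a)_n = a (a+1) ⋯ (a+n-1)`. -/
def aP (n : ℕ) (a : ℂ) : ℂ := (ascPochhammer ℂ n).eval a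

/-- The Whittaker function `W_{κ,μ}(r)` for `r > 0`, `Re(μ-κ+1/2) > 0`, defined by the integral
representation `W_{κ,μ}(r) = e^{-r/2} r^κ Γ(μ-κ+1/2)⁻¹ ∫_0^∞ t^{μ-κ-1/2} (1+t/r)^{μ+κ-1/2} e^{-t} dt`. -/
def whittakerW (κ μ : ℂ) (r : ℝ) : ℂ :=
  Complex.exp (-(r : ℂ) / 2) * (r : ℂ) ^ κ * (Complex.Gamma (μ - κ + 1 / 2))⁻¹ *
    ∫ t in Set.Ioi (0 : ℝ),
      (t : ℂ) ^ (μ - κ - 1 / 2) * ((1 + t / r : ℝ) : ℂ) ^ (μ + κ - 1 / 2) * Complex.exp (-(t : ℂ))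

open scoped Nat
open Set Filter Topology

/-- Integrand `t^{a-1} (1+t/r)^{b-1} e^{-t}` of the confluent hypergeometric integral. -/
def tricomiIntegrand (r : ℝ) (a b : ℂ) (t : ℝ) : ℂ :=
  (t : ℂ) ^ (a - 1) * ((1 + t / r : ℝ) : ℂ) ^ (b - 1) * Complex.exp (-(t : ℂ))

/-- The confluent hypergeometric integral `∫_0^∞ t^{a-1} (1+t/r)^{b-1} e^{-t} dt`. -/
def tricomiIntegral (r : ℝ) (a b : ℂ) : ℂ := ∫ t in Ioi (0 : ℝ), tricomiIntegrand r a b t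

lemma exists_rpow_one_add_div_le_exp {r : ℝ} (hr : 0 < r) (β : ℝ) :
    ∃ C : ℝ, ∀ t : ℝ, 0 < t → (1 + t / r) ^ β ≤ C * Real.exp (t / 2) := by
  obtain ⟨N, hN⟩ := exists_nat_ge β
  refine ⟨(2 / r) ^ N * N ! * Real.exp (r / 2), fun t ht => ?_⟩
  have hx : 1 ≤ 1 + t / r := le_add_of_nonneg_right (by positivity)
  have hexp := Real.pow_div_factorial_le_exp ((r + t) / 2) (by positivity) N
  rw [div_le_iff₀ (by positivity)] at hexp
  calc (1 + t / r) ^ β ≤ (1 + t / r) ^ (N : ℝ) := Real.rpow_le_rpow_of_exponent_le hx hN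
    _ = (2 / r) ^ N * ((r + t) / 2) ^ N := by
      rw [Real.rpow_natCast, ← mul_pow]
      congr 1
      field_simp
    _ ≤ (2 / r) ^ N * (Real.exp ((r + t) / 2) * N !) := by gcongr
    _ = (2 / r) ^ N * N ! * Real.exp (r / 2) * Real.exp (t / 2) := by
      rw [add_div, Real.exp_add]
      ring

lemma exists_norm_tricomiIntegrand_le {r : ℝ} (hr : 0 < r) (a b : ℂ) :
    ∃ C : ℝ, ∀ t : ℝ, 0 < t →
      ‖tricomiIntegrand r a b t‖ ≤ C * (t ^ (a.re - 1) * Real.exp (-(1 / 2) * t)) := by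
  obtain ⟨C, hC⟩ := exists_rpow_one_add_div_le_exp hr (b.re - 1)
  refine ⟨C, fun t ht => ?_⟩
  have hx : 0 < 1 + t / r := by positivity
  have hre : (-(t : ℂ)).re = -t := by simp
  rw [tricomiIntegrand, norm_mul, norm_mul, Complex.norm_cpow_eq_rpow_re_of_pos ht,
    Complex.norm_cpow_eq_rpow_re_of_pos hx, Complex.norm_exp, hre, Complex.sub_re,
    Complex.sub_re, Complex.one_re]
  calc t ^ (a.re - 1) * (1 + t / r) ^ (b.re - 1) * Real.exp (-t)
      ≤ t ^ (a.re - 1) * (C * Real.exp (t / 2)) * Real.exp (-t) := by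
        gcongr
        exact hC t ht
    _ = C * (t ^ (a.re - 1) * (Real.exp (t / 2) * Real.exp (-t))) := by ring
    _ = C * (t ^ (a.re - 1) * Real.exp (-(1 / 2) * t)) := by
        rw [← Real.exp_add]
        ring_nf

lemma continuousOn_tricomiIntegrand {r : ℝ} (hr : 0 < r) (a b : ℂ) :
    ContinuousOn (tricomiIntegrand r a b) (Ioi 0) := by
  intro t ht
  have ht : 0 < t := ht
  apply ContinuousAt.continuousWithinAt
  unfold tricomiIntegrand
  have hx : 0 < 1 + t / r := by positivity
  refine ContinuousAt.mul (ContinuousAt.mul ?_ ?_) (by fun_prop)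
  · exact ContinuousAt.cpow (by fun_prop) continuousAt_const (Complex.ofReal_mem_slitPlane.2 ht)
  · exact ContinuousAt.cpow (by fun_prop) continuousAt_const (Complex.ofReal_mem_slitPlane.2 hx)

lemma integrableOn_tricomiIntegrand {r : ℝ} (hr : 0 < r) {a : ℂ} (ha : 0 < a.re) (b : ℂ) :
    IntegrableOn (tricomiIntegrand r a b) (Ioi 0) := by
  obtain ⟨C, hC⟩ := exists_norm_tricomiIntegrand_le hr a b
  have hint := integrableOn_rpow_mul_exp_neg_mul_rpow (p := 1) (s := a.re - 1) (b := 1 / 2)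
    (by linarith) one_pos (by norm_num)
  simp only [Real.rpow_one] at hint
  refine Integrable.mono' (hint.const_mul C)
    ((continuousOn_tricomiIntegrand hr a b).aestronglyMeasurable measurableSet_Ioi) ?_
  filter_upwards [ae_restrict_mem measurableSet_Ioi] with t ht using hC t ht

lemma tricomiIntegrand_add_one_right {r t : ℝ} (hr : 0 < r) (ht : 0 < t) (a b : ℂ) :
    tricomiIntegrand r a (b + 1) t =
      tricomiIntegrand r a b t + tricomiIntegrand r (a + 1) b t / r := by
  have hx : ((1 + t / r : ℝ) : ℂ) ≠ 0 := Complex.ofReal_ne_zero.2 (by positivity)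
  have ht' : (t : ℂ) ≠ 0 := Complex.ofReal_ne_zero.2 ht.ne'
  simp only [tricomiIntegrand]
  rw [show b + 1 - 1 = b - 1 + 1 by ring, show a + 1 - 1 = a - 1 + 1 by ring,
    Complex.cpow_add _ _ hx, Complex.cpow_add _ _ ht', Complex.cpow_one, Complex.cpow_one]
  generalize ((1 + t / r : ℝ) : ℂ) ^ (b - 1) = u
  push_cast
  ring

lemma tricomiIntegral_add_one_right {r : ℝ} (hr : 0 < r) {a : ℂ} (ha : 0 < a.re) (b : ℂ) :
    tricomiIntegral r a (b + 1) = tricomiIntegral r a b + tricomiIntegral r (a + 1) b / r := by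
  have ha' : 0 < (a + 1).re := by
    rw [Complex.add_re, Complex.one_re]
    linarith
  simp only [tricomiIntegral]
  rw [← integral_div, ← integral_add (integrableOn_tricomiIntegrand hr ha b)
    ((integrableOn_tricomiIntegrand hr ha' b).div_const _)]
  exact setIntegral_congr_fun measurableSet_Ioi fun t ht =>
    tricomiIntegrand_add_one_right hr ht a b

lemma hasDerivAt_tricomiIntegrand {r t : ℝ} (hr : 0 < r) (ht : 0 < t) {a : ℂ} (ha : a ≠ 0)
    (b : ℂ) :
    HasDerivAt (tricomiIntegrand r (a + 1) (b + 1))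
      (a * tricomiIntegrand r a (b + 1) t + b / r * tricomiIntegrand r (a + 1) b t -
        tricomiIntegrand r (a + 1) (b + 1) t) t := by
  have hx : 0 < 1 + t / r := by positivity
  have h₁ := hasDerivAt_ofReal_cpow_const ht.ne' ha
  have hlin : HasDerivAt (fun z : ℂ => 1 + z / r) (1 / r) (t : ℂ) :=
    ((hasDerivAt_id (t : ℂ)).div_const (r : ℂ)).const_add 1
  have h₂ := (hlin.cpow_const (c := b) (by
    have := Complex.ofReal_mem_slitPlane.2 hx
    push_cast at this
    exact this)).comp_ofReal
  have h₃ := ((hasDerivAt_neg (t : ℂ)).cexp).comp_ofReal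
  have h := (h₁.mul h₂).mul h₃
  unfold tricomiIntegrand
  simp only [add_sub_cancel_right]
  push_cast
  refine h.congr_deriv ?_
  simp only [Pi.mul_apply]
  ring

lemma tendsto_tricomiIntegrand_atTop {r : ℝ} (hr : 0 < r) (a b : ℂ) :
    Tendsto (tricomiIntegrand r a b) atTop (𝓝 0) := by
  obtain ⟨C, hC⟩ := exists_norm_tricomiIntegrand_le hr a b
  have hlim := (tendsto_rpow_mul_exp_neg_mul_atTop_nhds_zero (a.re - 1) (1 / 2)
    (by norm_num)).const_mul C
  rw [mul_zero] at hlim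
  refine squeeze_zero_norm' ?_ hlim
  filter_upwards [eventually_gt_atTop 0] with t ht using hC t ht

lemma tricomiIntegral_by_parts {r : ℝ} (hr : 0 < r) {a : ℂ} (ha : 0 < a.re) (b : ℂ) :
    a * tricomiIntegral r a (b + 1) + b / r * tricomiIntegral r (a + 1) b =
      tricomiIntegral r (a + 1) (b + 1) := by
  have ha' : 0 < (a + 1).re := by
    rw [Complex.add_re, Complex.one_re]
    linarith
  have ha0 : a ≠ 0 := by
    rintro rfl
    simp at ha
  have i₁ := (integrableOn_tricomiIntegrand hr ha (b + 1)).const_mul a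
  have i₂ := (integrableOn_tricomiIntegrand hr ha' b).const_mul (b / r)
  have i₃ := integrableOn_tricomiIntegrand hr ha' (b + 1)
  have hcont : ContinuousWithinAt (tricomiIntegrand r (a + 1) (b + 1)) (Ici 0) 0 := by
    apply ContinuousAt.continuousWithinAt
    unfold tricomiIntegrand
    refine ContinuousAt.mul (ContinuousAt.mul ?_ ?_) (by fun_prop)
    · exact Complex.continuousAt_ofReal_cpow_const 0 _ (Or.inl (by simpa using ha))
    · exact ContinuousAt.cpow (by fun_prop) continuousAt_const (Complex.ofReal_mem_slitPlane.2 (by simp))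
  have hzero : tricomiIntegrand r (a + 1) (b + 1) 0 = 0 := by
    simp [tricomiIntegrand, Complex.zero_cpow ha0]
  have key := integral_Ioi_of_hasDerivAt_of_tendsto hcont
    (fun t ht => hasDerivAt_tricomiIntegrand hr ht ha0 b) ((i₁.add i₂).sub i₃)
    (tendsto_tricomiIntegrand_atTop hr _ _)
  rw [integral_sub (by exact i₁.add i₂) i₃, integral_add i₁ i₂, integral_const_mul, integral_const_mul,
    hzero, sub_zero] at key
  exact sub_eq_zero.1 key

lemma tricomiIntegral_contiguous {r : ℝ} (hr : 0 < r) {a : ℂ} (ha : 0 < a.re) (b : ℂ) :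
    (a + b) / r * tricomiIntegral r (a + 1) b =
      tricomiIntegral r (a + 1) (b + 1) - a * tricomiIntegral r a b := by
  rw [← tricomiIntegral_by_parts hr ha, tricomiIntegral_add_one_right hr ha]
  ring

lemma whittakerW_eq_tricomiIntegral (κ μ : ℂ) (r : ℝ) :
    whittakerW κ μ r = Complex.exp (-(r : ℂ) / 2) * (r : ℂ) ^ κ *
      (Complex.Gamma (μ - κ + 1 / 2))⁻¹ *
        tricomiIntegral r (μ - κ + 1 / 2) (μ + κ + 1 / 2) := by
  simp only [whittakerW, tricomiIntegral, tricomiIntegrand]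
  rw [show μ - κ + 1 / 2 - 1 = μ - κ - 1 / 2 by ring,
    show μ + κ + 1 / 2 - 1 = μ + κ - 1 / 2 by ring]

/-- The three-term relation `(2μ+1) r^{-1/2} W_{κ-1/2,μ+1/2} = W_{κ,μ+1} - W_{κ,μ}`. -/
lemma whittakerW_contiguous {r : ℝ} (hr : 0 < r) {κ μ : ℂ} (h : 0 < (μ - κ + 1 / 2).re) :
    (2 * μ + 1) * ((r ^ (-(1 : ℝ) / 2) : ℝ) : ℂ) * whittakerW (κ - 1 / 2) (μ + 1 / 2) r =
      whittakerW κ (μ + 1) r - whittakerW κ μ r := by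
  have hr' : (r : ℂ) ≠ 0 := Complex.ofReal_ne_zero.2 hr.ne'
  have ha0 : μ - κ + 1 / 2 ≠ 0 := by
    intro h0
    rw [h0] at h
    simp at h
  have hG : Complex.Gamma (μ - κ + 1 / 2) ≠ 0 := Complex.Gamma_ne_zero_of_re_pos h
  have key := tricomiIntegral_contiguous hr h (μ + κ + 1 / 2)
  have hpow : ((r ^ (-(1 : ℝ) / 2) : ℝ) : ℂ) * (r : ℂ) ^ (κ - 1 / 2) = (r : ℂ) ^ κ / r := by
    rw [Complex.ofReal_cpow hr.le, ← Complex.cpow_add _ _ hr', eq_div_iff hr']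
    nth_rewrite 2 [← Complex.cpow_one (r : ℂ)]
    rw [← Complex.cpow_add _ _ hr']
    congr 1
    push_cast
    ring
  simp only [whittakerW_eq_tricomiIntegral]
  rw [show μ + 1 / 2 - (κ - 1 / 2) + 1 / 2 = μ - κ + 1 / 2 + 1 by ring,
    show μ + 1 / 2 + (κ - 1 / 2) + 1 / 2 = μ + κ + 1 / 2 by ring,
    show μ + 1 - κ + 1 / 2 = μ - κ + 1 / 2 + 1 by ring,
    show μ + 1 + κ + 1 / 2 = μ + κ + 1 / 2 + 1 by ring, Complex.Gamma_add_one _ ha0,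
    show 2 * μ + 1 = μ - κ + 1 / 2 + (μ + κ + 1 / 2) by ring]
  generalize μ - κ + 1 / 2 = a at *
  generalize μ + κ + 1 / 2 = b at *
  generalize Complex.Gamma a = G at *
  calc _ = Complex.exp (-(r : ℂ) / 2) * (((r ^ (-(1 : ℝ) / 2) : ℝ) : ℂ) * (r : ℂ) ^ (κ - 1 / 2)) *
        (a * G)⁻¹ * ((a + b) * tricomiIntegral r (a + 1) b) := by ring
    _ = Complex.exp (-(r : ℂ) / 2) * (r : ℂ) ^ κ * (a * G)⁻¹ *
        ((a + b) / r * tricomiIntegral r (a + 1) b) := by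
      rw [hpow]
      ring
    _ = _ := by
      rw [key]
      field_simp

/-- The coefficient of `W_{κ,μ+ℓ}` in the summation formula, with `m = 2μ`. -/
def whittakerCoeff (n ℓ : ℕ) (m : ℂ) : ℂ :=
  (-1) ^ ℓ * (n.choose ℓ : ℂ) * ((m + 2 * ℓ) / aP (n + 1) (m + ℓ))

lemma aP_succ_right (n : ℕ) (a : ℂ) : aP (n + 1) a = aP n a * (a + n) :=
  ascPochhammer_succ_eval n a

lemma aP_succ_left (n : ℕ) (a : ℂ) : aP (n + 1) a = a * aP n (a + 1) := by
  simp [aP, ascPochhammer_succ_left]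

lemma whittakerCoeff_succ_zero (n : ℕ) (m : ℂ) :
    whittakerCoeff (n + 1) 0 m = whittakerCoeff n 0 m / (m + n + 1) := by
  simp only [whittakerCoeff, aP_succ_right (n + 1), Nat.choose_zero_right]
  push_cast
  rw [add_zero, ← add_assoc]
  simp only [div_eq_mul_inv, mul_inv]
  ring

lemma whittakerCoeff_succ_succ (n ℓ : ℕ) (m : ℂ) (h₀ : m + n + 1 ≠ 0) (h₁ : m + ℓ + 1 ≠ 0)
    (h₂ : m + ℓ + n + 2 ≠ 0) :
    whittakerCoeff (n + 1) (ℓ + 1) m =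
      (whittakerCoeff n (ℓ + 1) m - whittakerCoeff n ℓ (m + 2)) / (m + n + 1) := by
  have hA : (aP (n + 1) (m + ℓ + 1))⁻¹ = (m + ℓ + n + 2) * (aP (n + 2) (m + ℓ + 1))⁻¹ := by
    rw [aP_succ_right (n + 1),
      show m + ℓ + 1 + ((n + 1 : ℕ) : ℂ) = m + ℓ + n + 2 by push_cast; ring, mul_inv]
    field_simp
  have hB : (aP (n + 1) (m + ℓ + 2))⁻¹ = (m + ℓ + 1) * (aP (n + 2) (m + ℓ + 1))⁻¹ := by
    rw [aP_succ_left (n + 1), show m + ℓ + 1 + 1 = m + ℓ + 2 by ring, mul_inv]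
    field_simp
  have hpascal : ((n + 1).choose (ℓ + 1) : ℂ) = n.choose ℓ + n.choose (ℓ + 1) := by
    exact_mod_cast Nat.choose_succ_succ n ℓ
  have habsorb : ((n : ℂ) + 1) * n.choose ℓ = (n + 1).choose (ℓ + 1) * (ℓ + 1) := by
    exact_mod_cast Nat.add_one_mul_choose_eq n ℓ
  rw [hpascal] at habsorb
  rw [eq_div_iff h₀]
  simp only [whittakerCoeff, hpascal]
  rw [show m + ((ℓ + 1 : ℕ) : ℂ) = m + ℓ + 1 by push_cast; ring,
    show m + 2 + (ℓ : ℂ) = m + ℓ + 2 by ring, div_eq_mul_inv, div_eq_mul_inv, div_eq_mul_inv,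
    hA, hB]
  push_cast
  generalize (aP (n + 2) (m + ℓ + 1))⁻¹ = q
  linear_combination (-(-1) ^ ℓ * (m + 2 * ℓ + 2) * q) * habsorb

lemma sum_whittakerCoeff_succ (n : ℕ) (m : ℂ) (w : ℕ → ℂ)
    (hm : ∀ t : ℕ, t ≤ 2 * (n + 1) → m + t ≠ 0) :
    ∑ ℓ ∈ Finset.range (n + 2), whittakerCoeff (n + 1) ℓ m * w ℓ =
      (∑ ℓ ∈ Finset.range (n + 1), whittakerCoeff n ℓ m * w ℓ -
        ∑ ℓ ∈ Finset.range (n + 1), whittakerCoeff n ℓ (m + 2) * w (ℓ + 1)) / (m + n + 1) := by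
  have hlast : ∑ ℓ ∈ Finset.range (n + 1), whittakerCoeff n ℓ m * w ℓ =
      ∑ ℓ ∈ Finset.range (n + 2), whittakerCoeff n ℓ m * w ℓ := by
    rw [Finset.sum_range_succ _ (n + 1)]
    simp [whittakerCoeff]
  rw [hlast, Finset.sum_range_succ', Finset.sum_range_succ' _ (n + 1), whittakerCoeff_succ_zero,
    add_sub_right_comm, ← Finset.sum_sub_distrib, add_div, Finset.sum_div]
  congr 1
  · refine Finset.sum_congr rfl fun ℓ hℓ => ?_
    have hℓ : ℓ ≤ n := Nat.lt_succ_iff.1 (Finset.mem_range.1 hℓ)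
    have h₀ := hm (n + 1) (by omega)
    have h₁ := hm (ℓ + 1) (by omega)
    have h₂ := hm (ℓ + n + 2) (by omega)
    push_cast at h₀ h₁ h₂
    simp only [← add_assoc] at h₀ h₁ h₂
    rw [whittakerCoeff_succ_succ n ℓ m h₀ h₁ h₂]
    ring
  · ring

lemma sum_whittakerCoeff_mul_whittakerW {r : ℝ} (hr : 0 < r) (κ : ℂ) (n : ℕ) (μ : ℂ)
    (h1 : 0 < (μ - κ + 1 / 2).re) (h2 : ∀ t : ℕ, t ≤ 2 * n → 2 * μ + (t : ℂ) ≠ 0) :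
    ∑ ℓ ∈ Finset.range (n + 1), whittakerCoeff n ℓ (2 * μ) * whittakerW κ (μ + ℓ) r =
      (-1) ^ n * ((r ^ (-(n : ℝ) / 2) : ℝ) : ℂ) * whittakerW (κ - n / 2) (μ + n / 2) r := by
  induction n generalizing μ with
  | zero =>
    have h0 : μ ≠ 0 := by simpa using h2 0 le_rfl
    simp [whittakerCoeff, aP, h0]
  | succ n ih =>
    have h1' : 0 < (μ + 1 - κ + 1 / 2).re := by
      rw [show μ + 1 - κ + 1 / 2 = μ - κ + 1 / 2 + 1 by ring, Complex.add_re, Complex.one_re]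
      linarith
    have ih₀ := ih μ h1 fun t ht => h2 t (by omega)
    have ih₁ := ih (μ + 1) h1' fun t ht => by
      have := h2 (t + 2) (by omega)
      push_cast at this
      rwa [show 2 * (μ + 1) + (t : ℂ) = 2 * μ + (t + 2) by ring]
    have hshift : ∑ ℓ ∈ Finset.range (n + 1),
        whittakerCoeff n ℓ (2 * μ + 2) * whittakerW κ (μ + (ℓ + 1 : ℕ)) r =
        ∑ ℓ ∈ Finset.range (n + 1),
          whittakerCoeff n ℓ (2 * (μ + 1)) * whittakerW κ (μ + 1 + ℓ) r := by
      refine Finset.sum_congr rfl fun ℓ _ => ?_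
      push_cast
      ring_nf
    have hn : 2 * μ + n + 1 ≠ 0 := by
      have := h2 (n + 1) (by omega)
      push_cast at this
      rwa [add_assoc]
    have hre : 0 < (μ + n / 2 - (κ - n / 2) + 1 / 2).re := by
      rw [show μ + n / 2 - (κ - n / 2) + 1 / 2 = μ - κ + 1 / 2 + ((n : ℝ) : ℂ) by
        push_cast; ring, Complex.add_re, Complex.ofReal_re]
      positivity
    have hc := whittakerW_contiguous hr hre
    have hpow : r ^ (-((n + 1 : ℕ) : ℝ) / 2) = r ^ (-(n : ℝ) / 2) * r ^ (-(1 : ℝ) / 2) := by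
      rw [← Real.rpow_add hr]
      congr 1
      push_cast
      ring
    rw [sum_whittakerCoeff_succ n (2 * μ) (fun ℓ => whittakerW κ (μ + ℓ) r) h2, hshift, ih₀, ih₁,
      div_eq_iff hn, hpow]
    rw [show κ - ((n + 1 : ℕ) : ℂ) / 2 = κ - n / 2 - 1 / 2 by push_cast; ring,
      show μ + ((n + 1 : ℕ) : ℂ) / 2 = μ + n / 2 + 1 / 2 by push_cast; ring,
      show μ + 1 + (n : ℂ) / 2 = μ + n / 2 + 1 by ring, Complex.ofReal_mul]
    linear_combination ((-1) ^ n * ((r ^ (-(n : ℝ) / 2) : ℝ) : ℂ)) * hc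

/-- A summation formula for the Whittaker functions `W_{κ,μ}`. -/
theorem whittakerW_summation (n : ℕ) (r : ℝ) (hr : 0 < r) (κ μ : ℂ)
    (h1 : 0 < (μ - κ + 1 / 2).re) (h2 : ∀ t : ℕ, t ≤ 2 * n → 2 * μ + (t : ℂ) ≠ 0) :
    ∑ ℓ ∈ Finset.range (n + 1),
        (-1) ^ ℓ * (n.choose ℓ : ℂ) * ((2 * μ + 2 * ℓ) / aP (n + 1) (2 * μ + ℓ)) *
          whittakerW κ (μ + ℓ) r =
      (-1) ^ n * ((r ^ (-(n : ℝ) / 2) : ℝ) : ℂ) * whittakerW (κ - n / 2) (μ + n / 2) r :=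
  sum_whittakerCoeff_mul_whittakerW hr κ n μ h1 h2
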